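/- (Monotonicity part of Proposition 3.) Fix a player i and the strategies s_{-i} of all other players. The utility function s_i ↦ π_i(s_i, s_{-i}) is monotone nondecreasing: for all sets X ⊆ Y ⊆ V, π_i(X, s_{-i}) ≤ π_i(Y, s_{-i}). -/

import Mathlib

open Finset

/-- `seedCount s u` is `m_u(s)`, the number of players that include node `u`
in their seed set. -/
def seedCount {m n : ℕ} (s : Fin m → Finset (Fin n)) (u : Fin n) : ℕ :=
  (Finset.univ.filter (fun j => u ∈ s j)).card

/-- `seeded s` is `V_s`, the set of nodes seeded by at least one player. -/
def seeded {m n : ℕ} (s : Fin m → Finset (Fin n)) : Finset (Fin n) :=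
  Finset.univ.biUnion s

/-- `fPart c ε s i v` is `f^i_v(s) = Σ_{u ∈ s_i} c^u_v / m_u(s) + Σ_{u ∈ V ∖ V_s} ε·c^u_v`. -/
noncomputable def fPart {m n : ℕ} (c : Fin n → Fin n → ℝ) (ε : ℝ) (s : Fin m → Finset (Fin n))
    (i : Fin m) (v : Fin n) : ℝ :=
  (∑ u ∈ s i, c u v / (seedCount s u : ℝ)) + ∑ u ∈ Finset.univ \ seeded s, ε * c u v

/-- `fTot c ε s v` is `f_v(s) = Σ_{j ∈ M} f^j_v(s)`. -/
noncomputable def fTot {m n : ℕ} (c : Fin n → Fin n → ℝ) (ε : ℝ) (s : Fin m → Finset (Fin n))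
    (v : Fin n) : ℝ :=
  ∑ j : Fin m, fPart c ε s j v

/-- `gPart c ε s i v` is `g^i_v(s) = f^i_v(s) / f_v(s)`. -/
noncomputable def gPart {m n : ℕ} (c : Fin n → Fin n → ℝ) (ε : ℝ) (s : Fin m → Finset (Fin n))
    (i : Fin m) (v : Fin n) : ℝ :=
  fPart c ε s i v / fTot c ε s v

/-- `payoff c ε s i` is the utility `π_i(s) = (1/n) Σ_{v ∈ V} g^i_v(s)`. -/
noncomputable def payoff {m n : ℕ} (c : Fin n → Fin n → ℝ) (ε : ℝ) (s : Fin m → Finset (Fin n))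
    (i : Fin m) : ℝ :=
  (1 / (n : ℝ)) * ∑ v : Fin n, gPart c ε s i v

/-- The weight with which node `u` counts towards player `j`'s part of the influence. -/
noncomputable def share {m n : ℕ} (ε : ℝ) (s : Fin m → Finset (Fin n)) (j : Fin m)
    (u : Fin n) : ℝ :=
  if u ∈ s j then 1 / (seedCount s u : ℝ) else if u ∈ seeded s then 0 else ε

section Share

variable {m n : ℕ} {ε : ℝ} {s t : Fin m → Finset (Fin n)} {i j : Fin m} {u : Fin n}

lemma mem_seeded : u ∈ seeded s ↔ ∃ j, u ∈ s j := by
  simp [seeded]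

lemma seedCount_pos (h : u ∈ s j) : 0 < seedCount s u :=
  Finset.card_pos.2 ⟨j, by simpa using h⟩

lemma seedCount_le_card (s : Fin m → Finset (Fin n)) (u : Fin n) : seedCount s u ≤ m := by
  simpa [seedCount] using Finset.card_filter_le Finset.univ (fun j => u ∈ s j)

lemma seedCount_mono (hst : s ≤ t) : seedCount s u ≤ seedCount t u :=
  Finset.card_le_card (Finset.monotone_filter_right _ fun j _ hj => hst j hj)

lemma fPart_eq_sum_share (c : Fin n → Fin n → ℝ) (ε : ℝ) (s : Fin m → Finset (Fin n))
    (j : Fin m) (v : Fin n) : fPart c ε s j v = ∑ u, c u v * share ε s j u := by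
  have hseeds : ∑ u ∈ s j, c u v / (seedCount s u : ℝ)
      = ∑ u, if u ∈ s j then c u v / (seedCount s u : ℝ) else 0 := by
    simp
  have hrest : ∑ u ∈ Finset.univ \ seeded s, ε * c u v
      = ∑ u, if u ∉ seeded s then ε * c u v else 0 := by
    rw [← Finset.sum_filter]
    congr 1
    ext u
    simp
  rw [fPart, hseeds, hrest, ← Finset.sum_add_distrib]
  refine Finset.sum_congr rfl fun u _ => ?_
  by_cases hj : u ∈ s j
  · have hu : u ∈ seeded s := mem_seeded.2 ⟨j, hj⟩
    simp [share, hj, hu, div_eq_mul_inv]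
  · by_cases hu : u ∈ seeded s <;> simp [share, hj, hu, mul_comm]

lemma share_nonneg (hε : 0 ≤ ε) : 0 ≤ share ε s j u := by
  unfold share
  split_ifs <;> positivity

lemma exists_share_pos (hε : 0 < ε) (i : Fin m) (s : Fin m → Finset (Fin n)) (u : Fin n) :
    ∃ j, 0 < share ε s j u := by
  by_cases hu : u ∈ seeded s
  · obtain ⟨j, hj⟩ := mem_seeded.1 hu
    have hpos := seedCount_pos hj
    exact ⟨j, by rw [share, if_pos hj]; positivity⟩
  · have hi : u ∉ s i := fun h => hu (mem_seeded.2 ⟨i, h⟩)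
    exact ⟨i, by simpa [share, hi, hu] using hε⟩

/-- A player who enlarges her seed set does not decrease her own weight at any node. -/
lemma share_le_share_self (hε : 0 ≤ ε) (hεm : ε ≤ 1 / (m : ℝ)) (hi : s i ⊆ t i)
    (hst : ∀ j, j ≠ i → s j = t j) : share ε s i u ≤ share ε t i u := by
  have hagree (h : u ∈ s i ↔ u ∈ t i) (j : Fin m) : u ∈ s j ↔ u ∈ t j := by
    by_cases hj : j = i
    · rwa [hj]
    · rw [hst j hj]
  by_cases h : u ∈ s i ↔ u ∈ t i
  · have hmem := hagree h
    simp [share, seedCount, mem_seeded, hmem]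
  · have hs : u ∉ s i := fun hs => h ⟨fun _ => hi hs, fun _ => hs⟩
    have ht : u ∈ t i := by tauto
    by_cases hu : u ∈ seeded s
    · rw [share, if_neg hs, if_pos hu]
      exact share_nonneg hε
    · rw [share, share, if_neg hs, if_neg hu, if_pos ht]
      have hpos : (0 : ℝ) < seedCount t u := by exact_mod_cast seedCount_pos ht
      have hle : (seedCount t u : ℝ) ≤ m := by exact_mod_cast seedCount_le_card t u
      exact hεm.trans (one_div_le_one_div_of_le hpos hle)

/-- Enlarging the seed sets of others does not increase the weight of an unchanged player. -/
lemma share_le_share_of_eq (hε : 0 ≤ ε) (hst : s ≤ t) (hj : s j = t j) :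
    share ε t j u ≤ share ε s j u := by
  by_cases hu : u ∈ s j
  · have hpos : (0 : ℝ) < seedCount s u := by exact_mod_cast seedCount_pos hu
    have hle : (seedCount s u : ℝ) ≤ seedCount t u := by exact_mod_cast seedCount_mono hst
    rw [share, share, if_pos hu, if_pos (hj ▸ hu)]
    exact one_div_le_one_div_of_le hpos hle
  · by_cases ht : u ∈ seeded t
    · rw [share, if_neg (hj ▸ hu), if_pos ht]
      exact share_nonneg hε
    · have hs : u ∉ seeded s := fun h =>
        let ⟨k, hk⟩ := mem_seeded.1 h
        ht (mem_seeded.2 ⟨k, hst k hk⟩)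
      rw [share, share, if_neg hu, if_neg (hj ▸ hu), if_neg ht, if_neg hs]

end Share

section Payoff

variable {m n : ℕ} {c : Fin n → Fin n → ℝ} {ε : ℝ} {s t : Fin m → Finset (Fin n)}
  {i j : Fin m} {v : Fin n}

lemma fPart_nonneg (hc : ∀ u v, 0 ≤ c u v) (hε : 0 ≤ ε) : 0 ≤ fPart c ε s j v := by
  rw [fPart_eq_sum_share]
  exact Finset.sum_nonneg fun u _ => mul_nonneg (hc u v) (share_nonneg hε)

lemma fPart_le_fPart (hc : ∀ u v, 0 ≤ c u v) (h : ∀ u, share ε s j u ≤ share ε t j u) :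
    fPart c ε s j v ≤ fPart c ε t j v := by
  rw [fPart_eq_sum_share, fPart_eq_sum_share]
  exact Finset.sum_le_sum fun u _ => mul_le_mul_of_nonneg_left (h u) (hc u v)

lemma fTot_pos (hc : ∀ u v, 0 ≤ c u v) (hcsum : ∑ u, c u v = 1) (hε : 0 < ε) (i : Fin m) :
    0 < fTot c ε s v := by
  obtain ⟨u, -, hu⟩ : ∃ u ∈ Finset.univ, 0 < c u v :=
    Finset.exists_lt_of_sum_lt (by simp [hcsum])
  obtain ⟨j, hj⟩ := exists_share_pos hε i s u
  refine Finset.sum_pos' (fun k _ => fPart_nonneg hc hε.le) ⟨j, Finset.mem_univ j, ?_⟩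
  rw [fPart_eq_sum_share]
  exact Finset.sum_pos' (fun w _ => mul_nonneg (hc w v) (share_nonneg hε.le))
    ⟨u, Finset.mem_univ u, mul_pos hu hj⟩

lemma gPart_le_gPart (hc : ∀ u v, 0 ≤ c u v) (hcsum : ∑ u, c u v = 1) (hε : 0 < ε)
    (hεm : ε ≤ 1 / (m : ℝ)) (hi : s i ⊆ t i) (hst : ∀ j, j ≠ i → s j = t j) :
    gPart c ε s i v ≤ gPart c ε t i v := by
  have hle : s ≤ t := fun j => by
    by_cases hj : j = i
    · rw [hj]
      exact hi
    · exact (hst j hj).le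
  have hown : fPart c ε s i v ≤ fPart c ε t i v :=
    fPart_le_fPart hc fun _ => share_le_share_self hε.le hεm hi hst
  have hothers : ∑ j ∈ Finset.univ.erase i, fPart c ε t j v
      ≤ ∑ j ∈ Finset.univ.erase i, fPart c ε s j v :=
    Finset.sum_le_sum fun j hj => fPart_le_fPart hc fun _ =>
      share_le_share_of_eq hε.le hle (hst j (Finset.ne_of_mem_erase hj))
  have hothers_nonneg : 0 ≤ ∑ j ∈ Finset.univ.erase i, fPart c ε t j v :=
    Finset.sum_nonneg fun _ _ => fPart_nonneg hc hε.le
  have hcross := mul_le_mul hown hothers hothers_nonneg (fPart_nonneg hc hε.le)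
  rw [gPart, gPart, div_le_div_iff₀ (fTot_pos hc hcsum hε i) (fTot_pos hc hcsum hε i), fTot, fTot,
    ← Finset.add_sum_erase _ _ (Finset.mem_univ i), ← Finset.add_sum_erase _ _ (Finset.mem_univ i)]
  linarith

end Payoff

/-- Monotonicity part of Proposition 3: fixing a player `i` and the strategies of the other
players, the utility function `s_i ↦ π_i(s_i, s_{-i})` is monotone nondecreasing. -/
theorem payoff_monotone (m n : ℕ) (hm : 2 ≤ m) (hn : 1 ≤ n)
    (c : Fin n → Fin n → ℝ) (hc : ∀ u v, 0 ≤ c u v)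
    (hcsum : ∀ v : Fin n, ∑ u : Fin n, c u v = 1)
    (ε : ℝ) (hε : 0 < ε) (hε' : ε < 1 / (m : ℝ))
    (i : Fin m) (s : Fin m → Finset (Fin n))
    (X Y : Finset (Fin n)) (hXY : X ⊆ Y) :
    payoff c ε (Function.update s i X) i ≤ payoff c ε (Function.update s i Y) i := by
  refine mul_le_mul_of_nonneg_left (Finset.sum_le_sum fun v _ => ?_) (by positivity)
  exact gPart_le_gPart hc (hcsum v) hε hε'.le (by simpa using hXY) fun j hj => by simp [hj]
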